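/- arXiv:2109.01114 — 2 statements merged into one kernel-verified Lean document; each statement's English description precedes it below -/
import Mathlib

section
/- Define $W : SL_2(\mathbb{R}) \times SL_2(\mathbb{R}) \to \mathbb{Z}$ by the explicit sign table (as in Asai's theorem), and on the set $SL_2(\mathbb{R}) \times \mathbb{Z}$ define the operation $(\gamma_1, n_1) \cdot (\gamma_2, n_2) = (\gamma_1\gamma_2, n_1 + n_2 + W(\gamma_1, \gamma_2))$. Then this operation makes $SL_2(\mathbb{R}) \times \mathbb{Z}$ into a group, with identity $(I, 0)$ and the inverse of $(\gamma, n)$ given by $(\gamma^{-1}, -n - W(\gamma, \gamma^{-1}))$. -/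
open scoped Classical
open scoped Classical

/-- Asai's sign function on `SL₂(ℝ)`: the sign of the lower-left entry if nonzero,
otherwise the sign of the upper-left (equivalently diagonal) entry. -/
noncomputable def asaiSgn (γ : Matrix.SpecialLinearGroup (Fin 2) ℝ) : ℝ :=
  if (γ : Matrix (Fin 2) (Fin 2) ℝ) 1 0 ≠ 0 then
    Real.sign ((γ : Matrix (Fin 2) (Fin 2) ℝ) 1 0)
  else
    Real.sign ((γ : Matrix (Fin 2) (Fin 2) ℝ) 0 0)

/-- The 2-cocycle `W` defined from Asai's sign table. -/
noncomputable def asaiW (γ₁ γ₂ : Matrix.SpecialLinearGroup (Fin 2) ℝ) : ℤ :=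
  if asaiSgn γ₁ = 1 ∧ asaiSgn γ₂ = 1 ∧ asaiSgn (γ₁ * γ₂) = -1 then 1
  else if asaiSgn γ₁ = -1 ∧ asaiSgn γ₂ = -1 ∧ asaiSgn (γ₁ * γ₂) = 1 then -1
  else 0

/-- The multiplication on `SL₂(ℝ) × ℤ` twisted by Asai's cocycle `W`. -/
noncomputable def mulW (x y : Matrix.SpecialLinearGroup (Fin 2) ℝ × ℤ) :
    Matrix.SpecialLinearGroup (Fin 2) ℝ × ℤ :=
  (x.1 * y.1, x.2 + y.2 + asaiW x.1 y.1)

/-- The half plane of pairs `(c, d)` of positive sign. -/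
def PosRow (c d : ℝ) : Prop := 0 < c ∨ (c = 0 ∧ 0 < d)

theorem PosRow.smul {c d t : ℝ} (h : PosRow c d) (ht : 0 < t) : PosRow (t * c) (t * d) := by
  rcases h with h | ⟨h, h'⟩
  · exact Or.inl (mul_pos ht h)
  · exact Or.inr ⟨by rw [h, mul_zero], mul_pos ht h'⟩

theorem PosRow.add {c d c' d' : ℝ} (h : PosRow c d) (h' : PosRow c' d') :
    PosRow (c + c') (d + d') := by
  rcases h with h | ⟨h, k⟩ <;> rcases h' with h' | ⟨h', k'⟩
  · exact Or.inl (by linarith)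
  · exact Or.inl (by linarith)
  · exact Or.inl (by linarith)
  · exact Or.inr ⟨by linarith, by linarith⟩

theorem PosRow.not_neg {c d : ℝ} (h : PosRow c d) (h' : PosRow (-c) (-d)) : False := by
  rcases h with h | ⟨h, k⟩ <;> rcases h' with h' | ⟨h', k'⟩ <;> linarith

theorem asai_det (g : Matrix.SpecialLinearGroup (Fin 2) ℝ) :
    g.1 0 0 * g.1 1 1 - g.1 0 1 * g.1 1 0 = 1 := by
  rw [← Matrix.det_fin_two]; exact g.2

theorem asai_cases (g : Matrix.SpecialLinearGroup (Fin 2) ℝ) :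
    (asaiSgn g = 1 ∧ PosRow (g.1 1 0) (g.1 1 1)) ∨
    (asaiSgn g = -1 ∧ PosRow (-g.1 1 0) (-g.1 1 1)) := by
  have hd := asai_det g
  unfold asaiSgn
  rcases lt_trichotomy (g.1 1 0) 0 with h | h | h
  · right
    refine ⟨?_, Or.inl (by linarith)⟩
    rw [if_pos h.ne, Real.sign_of_neg h]
  · rw [if_neg (by simpa using h)]
    rw [h, mul_zero, sub_zero] at hd
    rcases lt_trichotomy (g.1 0 0) 0 with k | k | k
    · right
      refine ⟨Real.sign_of_neg k, Or.inr ⟨by linarith, ?_⟩⟩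
      by_contra hc
      nlinarith
    · rw [k] at hd; linarith
    · left
      refine ⟨Real.sign_of_pos k, Or.inr ⟨h, ?_⟩⟩
      by_contra hc
      nlinarith
  · left
    refine ⟨?_, Or.inl h⟩
    rw [if_pos h.ne', Real.sign_of_pos h]

theorem asai_one_iff (g : Matrix.SpecialLinearGroup (Fin 2) ℝ) :
    asaiSgn g = 1 ↔ PosRow (g.1 1 0) (g.1 1 1) := by
  rcases asai_cases g with ⟨h, k⟩ | ⟨h, k⟩
  · exact ⟨fun _ => k, fun _ => h⟩
  · refine ⟨fun h' => ?_, fun h' => (h'.not_neg k).elim⟩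
    rw [h] at h'; norm_num at h'

theorem asai_sgn_cases (g : Matrix.SpecialLinearGroup (Fin 2) ℝ) :
    asaiSgn g = 1 ∨ asaiSgn g = -1 := (asai_cases g).imp And.left And.left

theorem asai_neg (g : Matrix.SpecialLinearGroup (Fin 2) ℝ) : asaiSgn (-g) = -asaiSgn g := by
  unfold asaiSgn
  simp only [Matrix.SpecialLinearGroup.coe_neg, Matrix.neg_apply, neg_ne_zero, Real.sign_neg]
  split_ifs <;> rfl

theorem asai_key (a b c : Matrix.SpecialLinearGroup (Fin 2) ℝ)
    (ha : asaiSgn a = 1) (hb : asaiSgn b = 1) (hc : asaiSgn c = 1)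
    (habc : asaiSgn (a * b * c) = 1) : asaiSgn (a * b) = 1 ↔ asaiSgn (b * c) = 1 := by
  have hd := asai_det b
  rw [asai_one_iff] at *
  rw [asai_one_iff]
  simp only [Matrix.SpecialLinearGroup.coe_mul, Matrix.mul_apply, Fin.sum_univ_two] at *
  generalize a.1 1 0 = p at *
  generalize a.1 1 1 = q at *
  generalize b.1 0 0 = x at *
  generalize b.1 0 1 = y at *
  generalize b.1 1 0 = z at *
  generalize b.1 1 1 = w at *
  generalize c.1 0 0 = c0 at *
  generalize c.1 0 1 = c1 at *
  generalize c.1 1 0 = C at *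
  generalize c.1 1 1 = D at *
  have hp : 0 ≤ p := by rcases ha with h | h <;> linarith
  rcases hb with hz | ⟨hz, hw⟩
  · have h1 : PosRow ((p * x + q * z) * (z * c0 + w * C))
        ((p * x + q * z) * (z * c1 + w * D)) := by
      have h2 := habc.smul hz
      have e1 : z * ((p * x + q * z) * c0 + (p * y + q * w) * C) + p * C =
        (p * x + q * z) * (z * c0 + w * C) := by linear_combination (-p * C) * hd
      have e2 : z * ((p * x + q * z) * c1 + (p * y + q * w) * D) + p * D =
        (p * x + q * z) * (z * c1 + w * D) := by linear_combination (-p * D) * hd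
      rw [← e1, ← e2]
      rcases hp.eq_or_lt with h | h
      · subst h
        simpa using h2
      · exact h2.add (hc.smul h)
    rcases lt_trichotomy (p * x + q * z) 0 with hm | hm | hm
    · constructor
      · rintro (h | h) <;> linarith
      · intro h
        have h3 := h.smul (neg_pos.2 hm)
        rw [neg_mul, neg_mul] at h3
        exact (h1.not_neg h3).elim
    · rw [hm] at h1
      rcases h1 with h | h <;> simp at h
    · refine ⟨fun _ => ?_, fun _ => Or.inl hm⟩
      have h3 := h1.smul (inv_pos.2 hm)
      rwa [inv_mul_cancel_left₀ hm.ne', inv_mul_cancel_left₀ hm.ne'] at h3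
  · subst hz
    have hx : 0 < x := by
      by_contra h
      nlinarith
    refine ⟨fun _ => by simpa using hc.smul hw, fun _ => ?_⟩
    rcases ha with h | ⟨h, k⟩
    · exact Or.inl (by simpa using mul_pos h hx)
    · subst h
      exact Or.inr ⟨by simp, by simpa using mul_pos k hw⟩

theorem asaiW_formula (a b : Matrix.SpecialLinearGroup (Fin 2) ℝ) :
    4 * (asaiW a b : ℝ) = asaiSgn a + asaiSgn b - asaiSgn (a * b)
      - asaiSgn a * asaiSgn b * asaiSgn (a * b) := by
  unfold asaiW
  rcases asai_sgn_cases a with h | h <;> rcases asai_sgn_cases b with k | k <;>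
    rcases asai_sgn_cases (a * b) with l | l <;> rw [h, k, l] <;> norm_num

/-- The cocycle identity for the product of the three signs. -/
def SgnCoc (a b c : Matrix.SpecialLinearGroup (Fin 2) ℝ) : Prop :=
  asaiSgn a * asaiSgn b * asaiSgn (a * b) + asaiSgn (a * b) * asaiSgn c * asaiSgn (a * b * c) =
  asaiSgn b * asaiSgn c * asaiSgn (b * c) + asaiSgn a * asaiSgn (b * c) * asaiSgn (a * b * c)

theorem sgnCoc_pos (a b c : Matrix.SpecialLinearGroup (Fin 2) ℝ)
    (ha : asaiSgn a = 1) (hb : asaiSgn b = 1) (hc : asaiSgn c = 1) : SgnCoc a b c := by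
  unfold SgnCoc
  rw [ha, hb, hc]
  rcases asai_sgn_cases (a * b * c) with h | h
  · have := asai_key a b c ha hb hc h
    rcases asai_sgn_cases (a * b) with k | k <;> rcases asai_sgn_cases (b * c) with l | l <;>
      rw [k, l] at this ⊢ <;> rw [h] <;> norm_num at this <;> norm_num
  · rw [h]; ring

theorem sgnCoc_neg₁ (a b c : Matrix.SpecialLinearGroup (Fin 2) ℝ) (h : SgnCoc (-a) b c) :
    SgnCoc a b c := by
  unfold SgnCoc at *
  simp only [neg_mul, mul_neg, asai_neg, neg_neg] at h
  linarith

theorem sgnCoc_neg₂ (a b c : Matrix.SpecialLinearGroup (Fin 2) ℝ) (h : SgnCoc a (-b) c) :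
    SgnCoc a b c := by
  unfold SgnCoc at *
  simp only [neg_mul, mul_neg, asai_neg, neg_neg] at h
  linarith

theorem sgnCoc_neg₃ (a b c : Matrix.SpecialLinearGroup (Fin 2) ℝ) (h : SgnCoc a b (-c)) :
    SgnCoc a b c := by
  unfold SgnCoc at *
  simp only [neg_mul, mul_neg, asai_neg, neg_neg] at h
  linarith

theorem sgnCoc (a b c : Matrix.SpecialLinearGroup (Fin 2) ℝ) : SgnCoc a b c := by
  have key : ∀ g : Matrix.SpecialLinearGroup (Fin 2) ℝ, asaiSgn g = 1 ∨ asaiSgn (-g) = 1 := by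
    intro g
    rw [asai_neg]
    rcases asai_sgn_cases g with h | h
    · exact Or.inl h
    · right; rw [h]; norm_num
  have h1 : ∀ a b c, asaiSgn a = 1 → asaiSgn b = 1 → SgnCoc a b c := fun a b c ha hb =>
    (key c).elim (sgnCoc_pos a b c ha hb) fun h => sgnCoc_neg₃ _ _ _ (sgnCoc_pos _ _ _ ha hb h)
  have h2 : ∀ a b c, asaiSgn a = 1 → SgnCoc a b c := fun a b c ha =>
    (key b).elim (h1 a b c ha) fun h => sgnCoc_neg₂ _ _ _ (h1 _ _ _ ha h)
  exact (key a).elim (h2 a b c) fun h => sgnCoc_neg₁ _ _ _ (h2 _ _ _ h)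

theorem asaiW_cocycle (a b c : Matrix.SpecialLinearGroup (Fin 2) ℝ) :
    asaiW a b + asaiW (a * b) c = asaiW b c + asaiW a (b * c) := by
  have h := sgnCoc a b c
  unfold SgnCoc at h
  have h1 := asaiW_formula a b
  have h2 := asaiW_formula (a * b) c
  have h3 := asaiW_formula b c
  have h4 := asaiW_formula a (b * c)
  rw [← mul_assoc] at h4
  have : (asaiW a b + asaiW (a * b) c : ℝ) = asaiW b c + asaiW a (b * c) := by linarith
  exact_mod_cast this

theorem asai_one : asaiSgn 1 = 1 := by
  simp [asaiSgn, Real.sign_one]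

theorem asaiW_one_left (g : Matrix.SpecialLinearGroup (Fin 2) ℝ) : asaiW 1 g = 0 := by
  have h := asaiW_formula 1 g
  rw [one_mul, asai_one] at h
  have : (asaiW 1 g : ℝ) = 0 := by
    rcases asai_sgn_cases g with k | k <;> rw [k] at h <;> linarith
  exact_mod_cast this

theorem asaiW_one_right (g : Matrix.SpecialLinearGroup (Fin 2) ℝ) : asaiW g 1 = 0 := by
  have h := asaiW_formula g 1
  rw [mul_one, asai_one] at h
  have : (asaiW g 1 : ℝ) = 0 := by
    rcases asai_sgn_cases g with k | k <;> rw [k] at h <;> linarith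
  exact_mod_cast this

theorem asaiW_inv_comm (g : Matrix.SpecialLinearGroup (Fin 2) ℝ) :
    asaiW g⁻¹ g = asaiW g g⁻¹ := by
  have h := asaiW_cocycle g g⁻¹ g
  rw [mul_inv_cancel, inv_mul_cancel, asaiW_one_left, asaiW_one_right] at h
  linarith

/-- `SL₂(ℝ) × ℤ` with the multiplication twisted by Asai's cocycle is a group,
with identity `(I, 0)` and inverse of `(γ, n)` given by `(γ⁻¹, -n - W(γ, γ⁻¹))`. -/
theorem mulW_group_structure :
    (∀ x y z : Matrix.SpecialLinearGroup (Fin 2) ℝ × ℤ,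
      mulW (mulW x y) z = mulW x (mulW y z)) ∧
    (∀ x : Matrix.SpecialLinearGroup (Fin 2) ℝ × ℤ, mulW (1, 0) x = x) ∧
    (∀ x : Matrix.SpecialLinearGroup (Fin 2) ℝ × ℤ, mulW x (1, 0) = x) ∧
    (∀ (γ : Matrix.SpecialLinearGroup (Fin 2) ℝ) (n : ℤ),
      mulW (γ, n) (γ⁻¹, -n - asaiW γ γ⁻¹) = (1, 0)) ∧
    (∀ (γ : Matrix.SpecialLinearGroup (Fin 2) ℝ) (n : ℤ),
      mulW (γ⁻¹, -n - asaiW γ γ⁻¹) (γ, n) = (1, 0)) := by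
  refine ⟨fun x y z => ?_, fun x => ?_, fun x => ?_, fun γ n => ?_, fun γ n => ?_⟩
  · have h := asaiW_cocycle x.1 y.1 z.1
    refine Prod.ext (mul_assoc _ _ _) ?_
    simp only [mulW]
    linarith
  · simp [mulW, asaiW_one_left]
  · simp [mulW, asaiW_one_right]
  · simp [mulW]
    ring
  · simp [mulW, asaiW_inv_comm]
    ring
end

section
/- Let $2 \leq p < q$ be coprime integers with $(p,q) \neq (2,3)$, and let $(x, y) \in \mathbb{Z}^2$ satisfy $px + qy = 1$, $|x| < q$, $|y| < p$, and $xy < 0$. Set $\gamma = U_q^{-x} S_p^{-y} \in SL_2(\mathbb{R})$, where $S_p = \begin{pmatrix} 0 & -1 \\ 1 & 2\cos\frac{\pi}{p} \end{pmatrix}$ and $U_q = \begin{pmatrix} 2\cos\frac{\pi}{q} & -1 \\ 1 & 0 \end{pmatrix}$. Then $\mathrm{tr}\,\gamma > 2$ and the lower-left entry of $\gamma$ is positive. -/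
open Real

/-- The matrix `S_p` as an element of `SL₂(ℝ)`. -/
noncomputable def Sp (p : ℕ) : Matrix.SpecialLinearGroup (Fin 2) ℝ :=
  ⟨!![0, -1; 1, 2 * Real.cos (Real.pi / p)], by simp [Matrix.det_fin_two_of]⟩

/-- The matrix `U_q` as an element of `SL₂(ℝ)`. -/
noncomputable def Uq (q : ℕ) : Matrix.SpecialLinearGroup (Fin 2) ℝ :=
  ⟨!![2 * Real.cos (Real.pi / q), -1; 1, 0], by simp [Matrix.det_fin_two_of]⟩

lemma Uq_zpow (q : ℕ) (hs : Real.sin (π / q) ≠ 0) (n : ℤ) :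
    ((Uq q ^ n : Matrix.SpecialLinearGroup (Fin 2) ℝ) : Matrix (Fin 2) (Fin 2) ℝ) =
    !![Real.sin (n * (π / q) + π / q) / Real.sin (π / q), -(Real.sin (n * (π / q)) / Real.sin (π / q));
       Real.sin (n * (π / q)) / Real.sin (π / q), -(Real.sin (n * (π / q) - π / q) / Real.sin (π / q))] := by
  induction n using Int.induction_on with
  | zero => 
    ext i j
    fin_cases i <;> fin_cases j <;> simp [hs, neg_div]
  | succ k ih =>
    rw [zpow_add_one, Matrix.SpecialLinearGroup.coe_mul, ih]
    have h := Real.sin_sq_add_cos_sq (π / q)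
    ext i j
    fin_cases i <;> fin_cases j <;>
      simp [Uq, Matrix.mul_apply, Fin.sum_univ_two, add_mul, Real.sin_add, Real.cos_add, Real.sin_sub] <;>
      field_simp <;> generalize Real.sin (π / q) = s at * <;> generalize Real.cos (π / q) = c at * <;>
      grind
  | pred k ih =>
    rw [zpow_sub_one, Matrix.SpecialLinearGroup.coe_mul, ih, Matrix.SpecialLinearGroup.coe_inv, Matrix.adjugate_fin_two]
    have h := Real.sin_sq_add_cos_sq (π / q)
    ext i j
    fin_cases i <;> fin_cases j <;>
      simp [Uq, Matrix.mul_apply, Fin.sum_univ_two, sub_mul, Real.sin_add, Real.cos_add, Real.sin_sub, Real.cos_sub] <;>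
      field_simp <;> generalize Real.sin (π / q) = s at * <;> generalize Real.cos (π / q) = c at * <;>
      grind

lemma Sp_zpow (q : ℕ) (hs : Real.sin (π / q) ≠ 0) (n : ℤ) :
    ((Sp q ^ n : Matrix.SpecialLinearGroup (Fin 2) ℝ) : Matrix (Fin 2) (Fin 2) ℝ) =
    !![-(Real.sin (n * (π / q) - π / q) / Real.sin (π / q)), -(Real.sin (n * (π / q)) / Real.sin (π / q));
       Real.sin (n * (π / q)) / Real.sin (π / q), (Real.sin (n * (π / q) + π / q) / Real.sin (π / q))] := by
  induction n using Int.induction_on with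
  | zero => 
    ext i j
    fin_cases i <;> fin_cases j <;> simp [hs, neg_div]
  | succ k ih =>
    rw [zpow_add_one, Matrix.SpecialLinearGroup.coe_mul, ih]
    have h := Real.sin_sq_add_cos_sq (π / q)
    ext i j
    fin_cases i <;> fin_cases j <;>
      simp [Sp, Matrix.mul_apply, Fin.sum_univ_two, add_mul, Real.sin_add, Real.cos_add, Real.sin_sub] <;>
      field_simp <;> generalize Real.sin (π / q) = s at * <;> generalize Real.cos (π / q) = c at * <;>
      grind
  | pred k ih =>
    rw [zpow_sub_one, Matrix.SpecialLinearGroup.coe_mul, ih, Matrix.SpecialLinearGroup.coe_inv, Matrix.adjugate_fin_two]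
    have h := Real.sin_sq_add_cos_sq (π / q)
    ext i j
    fin_cases i <;> fin_cases j <;>
      simp [Sp, Matrix.mul_apply, Fin.sum_univ_two, sub_mul, Real.sin_add, Real.cos_add, Real.sin_sub, Real.cos_sub] <;>
      field_simp <;> generalize Real.sin (π / q) = s at * <;> generalize Real.cos (π / q) = c at * <;>
      grind

lemma sin_lt_aux {a t : ℝ} (ht : 0 < t) (h1 : t < a) (h2 : a < π - t) :
    Real.sin t < Real.sin a := by
  have h : Real.sin a - Real.sin t = 2 * Real.sin ((a - t) / 2) * Real.cos ((a + t) / 2) :=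
    Real.sin_sub_sin a t
  have := Real.sin_pos_of_pos_of_lt_pi (x := (a - t) / 2) (by linarith) (by linarith)
  have := Real.cos_pos_of_mem_Ioo (x := (a + t) / 2) ⟨by linarith, by linarith⟩
  have : 0 < 2 * Real.sin ((a - t) / 2) * Real.cos ((a + t) / 2) := by positivity
  linarith

lemma sin_le_aux {a t : ℝ} (ht : 0 < t) (h1 : t ≤ a) (h2 : a ≤ π - t) :
    Real.sin t ≤ Real.sin a := by
  rcases h1.eq_or_lt with h | h
  · rw [h]
  rcases h2.eq_or_lt with h' | h'
  · rw [h', Real.sin_pi_sub]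
  exact (sin_lt_aux ht h h').le

lemma cos_abs_aux {a t : ℝ} (ht : 0 < t) (h1 : t ≤ a) (h2 : a ≤ π - t) :
    |Real.cos a| ≤ Real.cos t := by
  rw [abs_le]
  constructor
  · rw [← Real.cos_pi_sub]
    exact Real.cos_le_cos_of_nonneg_of_le_pi (by linarith) (by linarith) h2
  · exact Real.cos_le_cos_of_nonneg_of_le_pi (by linarith) (by linarith) h1

set_option maxHeartbeats 1000000 in
lemma core (p q N M : ℤ) (hp : 2 ≤ p) (hpq : p < q) (hne : ¬(p = 2 ∧ q = 3))
    (hN : 0 < N) (hN' : N < q) (hM : 0 < M) (hM' : M < p)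
    (h : p * N - q * M = 1 ∨ p * N - q * M = -1) (α β a b : ℝ) (hα : α = π / p) (hβ : β = π / q)
    (ha : a = N * β) (hb : b = M * α) :
    (0 < Real.sin α ∧ 0 < Real.sin β) ∧
    Real.sin α * Real.sin β < Real.sin a * Real.sin b * (1 + Real.cos α * Real.cos β)
      + Real.cos a * Real.cos b * (Real.sin α * Real.sin β) ∧
    0 < Real.sin b * Real.sin (a - β) + Real.sin a * Real.sin (b + α) ∧
    0 < Real.sin b * Real.sin (a + β) + Real.sin a * Real.sin (b - α) := by
  have hpi := Real.pi_pos
  have hpR : (2:ℝ) ≤ p := by exact_mod_cast hp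
  have hqR : (2:ℝ) < q := by exact_mod_cast (by omega : 2 < q)
  have hpα : p * α = π := by rw [hα]; field_simp
  have hqβ : q * β = π := by rw [hβ]; field_simp
  have hα0 : 0 < α := by rw [hα]; positivity
  have hβ0 : 0 < β := by rw [hβ]; positivity
  have hα2 : α ≤ π / 2 := by nlinarith
  have hβ2 : β < π / 2 := by nlinarith
  have hNR : (1:ℝ) ≤ N := by exact_mod_cast hN
  have hMR : (1:ℝ) ≤ M := by exact_mod_cast hM
  have hNR' : (N:ℝ) + 1 ≤ q := by exact_mod_cast hN'
  have hMR' : (M:ℝ) + 1 ≤ p := by exact_mod_cast hM'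
  have ha1 : β ≤ a := by nlinarith
  have ha2 : a ≤ π - β := by nlinarith
  have hb1 : α ≤ b := by nlinarith
  have hb2 : b ≤ π - α := by nlinarith
  have sα := Real.sin_pos_of_pos_of_lt_pi hα0 (by linarith)
  have sβ := Real.sin_pos_of_pos_of_lt_pi hβ0 (by linarith)
  have sa := sin_le_aux hβ0 ha1 ha2
  have sb := sin_le_aux hα0 hb1 hb2
  have ca := cos_abs_aux hβ0 ha1 ha2
  have cb := cos_abs_aux hα0 hb1 hb2
  have cα : 0 ≤ Real.cos α := Real.cos_nonneg_of_mem_Icc ⟨by linarith, by linarith⟩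
  have cβ : 0 < Real.cos β := Real.cos_pos_of_mem_Ioo ⟨by linarith, by linarith⟩
  have t1 : 0 ≤ Real.sin (a - β) := Real.sin_nonneg_of_nonneg_of_le_pi (by linarith) (by linarith)
  have t2 : 0 ≤ Real.sin (a + β) := Real.sin_nonneg_of_nonneg_of_le_pi (by linarith) (by linarith)
  have t3 : 0 ≤ Real.sin (b - α) := Real.sin_nonneg_of_nonneg_of_le_pi (by linarith) (by linarith)
  have t4 : 0 ≤ Real.sin (b + α) := Real.sin_nonneg_of_nonneg_of_le_pi (by linarith) (by linarith)
  have sa0 : 0 < Real.sin a := by linarith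
  have sb0 : 0 < Real.sin b := by linarith
  refine ⟨⟨sα, sβ⟩, ?_⟩
  have hcc : -(Real.cos α * Real.cos β) ≤ Real.cos a * Real.cos b := by
    have : |Real.cos a * Real.cos b| ≤ Real.cos β * Real.cos α := by
      rw [abs_mul]; gcongr
    have := (abs_le.1 this).1
    linarith
  have hss : Real.sin α * Real.sin β ≤ Real.sin a * Real.sin b := by
    rw [mul_comm]; gcongr
  have hst := mul_pos sα sβ
  by_cases hgen : 2 ≤ N ∧ N + 2 ≤ q
  · obtain ⟨g1, g2⟩ := hgen
    have g1R : (2:ℝ) ≤ N := by exact_mod_cast g1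
    have g2R : (N:ℝ) + 2 ≤ q := by exact_mod_cast g2
    have ha1' : β < a := by nlinarith
    have ha2' : a < π - β := by nlinarith
    have sa' := sin_lt_aux hβ0 ha1' ha2'
    have u1 : 0 < Real.sin (a - β) := Real.sin_pos_of_pos_of_lt_pi (by linarith) (by linarith)
    have u2 : 0 < Real.sin (a + β) := Real.sin_pos_of_pos_of_lt_pi (by linarith) (by linarith)
    have hss' : Real.sin α * Real.sin β < Real.sin a * Real.sin b := by
      nlinarith
    refine ⟨?_, by positivity, by positivity⟩
    linarith [mul_le_mul_of_nonneg_right hcc hst.le,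
      mul_nonneg (mul_nonneg cα cβ.le) (sub_nonneg.2 hss)]
  · have key : (N = 1 ∧ M = 1 ∨ N = q - 1 ∧ M = p - 1) ∧ 3 ≤ p := by
      have hN2 : N = 1 ∨ N = q - 1 := by omega
      rcases hN2 with hn | hn
      · subst hn
        have hM1 : M = 1 := by
          by_contra hc
          have : 2 ≤ M := by omega
          rcases h with h | h <;> nlinarith
        subst hM1
        omega
      · have hM1 : M = p - 1 := by
          by_contra hc
          have : M ≤ p - 2 := by omega
          subst hn
          rcases h with h | h <;> nlinarith
        subst hn
        subst hM1
        refine ⟨Or.inr ⟨rfl, rfl⟩, ?_⟩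
        rcases h with h | h <;> ring_nf at h <;> omega
    obtain ⟨key, hp3⟩ := key
    have hp3R : (3:ℝ) ≤ p := by exact_mod_cast hp3
    have hα2' : α < π / 2 := by nlinarith
    have cα' : 0 < Real.cos α := Real.cos_pos_of_mem_Ioo ⟨by linarith, by linarith⟩
    have hcp := mul_pos cα' cβ
    have hcc' : Real.cos a * Real.cos b = Real.cos α * Real.cos β ∧
       0 < Real.sin (a - β) + Real.sin (b + α) ∧ 0 < Real.sin (a + β) + Real.sin (b - α) := by
      rcases key with ⟨k1, k2⟩ | ⟨k1, k2⟩
      · have e1 : a = β := by rw [ha, k1]; simp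
        have e2 : b = α := by rw [hb, k2]; simp
        have u4 : 0 < Real.sin (b + α) := Real.sin_pos_of_pos_of_lt_pi (by linarith) (by linarith)
        have u2 : 0 < Real.sin (a + β) := Real.sin_pos_of_pos_of_lt_pi (by linarith) (by linarith)
        refine ⟨by rw [e1, e2]; ring, by linarith, by linarith⟩
      · have e1 : a = π - β := by rw [ha, k1]; push_cast; linarith
        have e2 : b = π - α := by rw [hb, k2]; push_cast; linarith
        have u1 : 0 < Real.sin (a - β) := Real.sin_pos_of_pos_of_lt_pi (by linarith) (by linarith)
        have u3 : 0 < Real.sin (b - α) := Real.sin_pos_of_pos_of_lt_pi (by linarith) (by linarith)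
        refine ⟨by rw [e1, e2, Real.cos_pi_sub, Real.cos_pi_sub]; ring, by linarith, by linarith⟩
    obtain ⟨e, v1, v2⟩ := hcc'
    refine ⟨?_, ?_, ?_⟩
    · rw [e]
      linarith [mul_nonneg hcp.le (sub_nonneg.2 hss), mul_pos hcp hst]
    · rcases t1.eq_or_lt with h0 | h0
      · have : 0 < Real.sin (b + α) := by linarith
        positivity
      · positivity
    · rcases t2.eq_or_lt with h0 | h0
      · have : 0 < Real.sin (b - α) := by linarith
        positivity
      · positivity

theorem trace_gt_two_of_bezout (p q : ℕ) (hp : 2 ≤ p) (hpq : p < q)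
    (hco : Nat.Coprime p q) (hne : ¬(p = 2 ∧ q = 3))
    (x y : ℤ) (hbez : (p : ℤ) * x + (q : ℤ) * y = 1)
    (hx : |x| < (q : ℤ)) (hy : |y| < (p : ℤ)) (hxy : x * y < 0) :
    2 < Matrix.trace ((Uq q ^ (-x) * Sp p ^ (-y) :
        Matrix.SpecialLinearGroup (Fin 2) ℝ) : Matrix (Fin 2) (Fin 2) ℝ) ∧
    0 < ((Uq q ^ (-x) * Sp p ^ (-y) :
        Matrix.SpecialLinearGroup (Fin 2) ℝ) : Matrix (Fin 2) (Fin 2) ℝ) 1 0 := by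
  have hxy0 : (x < 0 ∧ 0 < y) ∨ (0 < x ∧ y < 0) := by
    rcases mul_neg_iff.1 hxy with h | h
    · exact Or.inr h
    · exact Or.inl h
  rw [abs_lt] at hx hy
  have hne' : ¬((p : ℤ) = 2 ∧ (q : ℤ) = 3) := by omega
  rcases hxy0 with ⟨h1, h2⟩ | ⟨h1, h2⟩
  · obtain ⟨⟨sα, sβ⟩, c1, c2, c3⟩ := core p q (-x) y (by omega) (by omega) hne' (by omega) (by omega)
      h2 hy.2 (Or.inr (by linarith)) (π / p) (π / q) _ _ (by simp) (by simp) rfl rfl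
    rw [Matrix.SpecialLinearGroup.coe_mul, Uq_zpow q sβ.ne', Sp_zpow p sα.ne']
    push_cast at *
    generalize (π / p) = α at *
    generalize (π / q) = β at *
    rw [neg_mul (y : ℝ)]
    generalize (-(x : ℝ)) * β = a at *
    generalize (y : ℝ) * α = b at *
    simp only [Matrix.trace_fin_two, Matrix.mul_apply, Fin.sum_univ_two, Matrix.of_apply,
      Matrix.cons_val', Matrix.cons_val_zero, Matrix.cons_val_one, Matrix.cons_val_fin_one]
    simp only [Real.sin_add, Real.sin_sub, Real.sin_neg, Real.cos_neg] at *
    generalize Real.sin α = s at *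
    generalize Real.sin β = t at *
    constructor
    · rw [← sub_pos]
      have := div_pos (sub_pos.2 c1) (mul_pos sα sβ)
      refine (mul_pos two_pos this).trans_eq ?_
      field_simp
      ring
    · refine (div_pos c2 (mul_pos sα sβ)).trans_eq ?_
      field_simp
      ring
  · obtain ⟨⟨sα, sβ⟩, c1, c2, c3⟩ := core p q x (-y) (by omega) (by omega) hne' (by omega) (by omega)
      (by omega) (by omega) (Or.inl (by linarith)) (π / p) (π / q) _ _ (by simp) (by simp) rfl rfl
    rw [Matrix.SpecialLinearGroup.coe_mul, Uq_zpow q sβ.ne', Sp_zpow p sα.ne']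
    push_cast at *
    generalize (π / p) = α at *
    generalize (π / q) = β at *
    rw [neg_mul (x : ℝ)]
    generalize (x : ℝ) * β = a at *
    generalize (-(y : ℝ)) * α = b at *
    simp only [Matrix.trace_fin_two, Matrix.mul_apply, Fin.sum_univ_two, Matrix.of_apply,
      Matrix.cons_val', Matrix.cons_val_zero, Matrix.cons_val_one, Matrix.cons_val_fin_one]
    simp only [Real.sin_add, Real.sin_sub, Real.sin_neg, Real.cos_neg] at *
    generalize Real.sin α = s at *
    generalize Real.sin β = t at *
    constructor
    · rw [← sub_pos]
      have := div_pos (sub_pos.2 c1) (mul_pos sα sβ)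
      refine (mul_pos two_pos this).trans_eq ?_
      field_simp
      ring
    · refine (div_pos c3 (mul_pos sα sβ)).trans_eq ?_
      field_simp
      ring
end
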